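/- For a smooth function F : ℝ² → ℝ and all integers n ≥ 1 and k, the quantities I_{n,k} satisfy the recurrence I_{n+1,k} = ∂/∂x I_{n,k} + F_x · ∂/∂y I_{n,k−1} + (k−1)·F_xy · I_{n,k−1} + (k−2)·F_x·F_yy · I_{n,k−2}, where each I_{n,j} is viewed as a function of (x, y) and F_x, F_xy, F_yy denote partial derivatives of F. -/

import Mathlib

/-- `pd F a b x y = ∂^(a+b) F / ∂x^a ∂y^b` evaluated at `(x, y)`:
differentiate `F` `a` times in the first variable, then `b` times in the second. -/
noncomputable def pd (F : ℝ → ℝ → ℝ) (a b : ℕ) (x y : ℝ) : ℝ :=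
  iteratedDeriv b (fun y' => iteratedDeriv a (fun x' => F x' y') x) y

open scoped Classical in
/-- `iSum F n k x y` is `I_{n,k}` evaluated at `(x, y)`: the sum over all set
partitions of `{1, …, n+k−1}` (encoded as `Fin (n + k - 1)`; the *small*
elements `{1, …, n}` correspond to values `< n` and the *large* elements
`{n+1, …, n+k−1}` to values `≥ n`) into `k` blocks in which no large element
lies in a singleton block, of the products over the blocks `B` of
`∂^(a+b)F/∂x^a∂y^b`, where `a` is the number of small and `b` the number of
large elements of `B`.  It is `0` when `k < 1` or when no such partition
exists (empty sum). -/
noncomputable def iSum (F : ℝ → ℝ → ℝ) (n : ℕ) (k : ℤ) (x y : ℝ) : ℝ :=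
  if k < 1 then 0 else
    ∑ part ∈ Finset.univ.filter (fun part : Finset (Finset (Fin (n + k.toNat - 1))) =>
        (∀ B ∈ part, B.Nonempty) ∧
        (∀ i, ∃! B, B ∈ part ∧ i ∈ B) ∧
        part.card = k.toNat ∧
        ∀ B ∈ part, B.card = 1 → ∀ i ∈ B, (i : ℕ) < n),
      ∏ B ∈ part,
        pd F (B.filter (fun i => (i : ℕ) < n)).card
             (B.filter (fun i => ¬ (i : ℕ) < n)).card x y

lemma hasDeriv_x {G : ℝ × ℝ → ℝ} (hG : ContDiff ℝ (⊤ : ℕ∞) G) (x y : ℝ) :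
    HasDerivAt (fun x' => G (x', y)) (fderiv ℝ G (x, y) (1, 0)) x := by
  have h1 : HasFDerivAt G (fderiv ℝ G (x, y)) (x, y) :=
    (hG.differentiable (by simp) _).hasFDerivAt
  exact h1.comp_hasDerivAt (f := fun x' => (x', y)) x ((hasDerivAt_id x).prodMk (hasDerivAt_const x y))

lemma hasDeriv_y {G : ℝ × ℝ → ℝ} (hG : ContDiff ℝ (⊤ : ℕ∞) G) (x y : ℝ) :
    HasDerivAt (fun y' => G (x, y')) (fderiv ℝ G (x, y) (0, 1)) y := by
  have h1 : HasFDerivAt G (fderiv ℝ G (x, y)) (x, y) :=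
    (hG.differentiable (by simp) _).hasFDerivAt
  exact h1.comp_hasDerivAt (f := fun y' => (x, y')) y ((hasDerivAt_const y x).prodMk (hasDerivAt_id y))

lemma smooth_fd {G : ℝ × ℝ → ℝ} (hG : ContDiff ℝ (⊤ : ℕ∞) G) (v : ℝ × ℝ) :
    ContDiff ℝ (⊤ : ℕ∞) (fun p => fderiv ℝ G p v) :=
  (hG.fderiv_right (m := (⊤ : ℕ∞)) (by simp)).clm_apply contDiff_const

lemma fd_fd {G : ℝ × ℝ → ℝ} (hG : ContDiff ℝ (⊤ : ℕ∞) G) (v w p : ℝ × ℝ) :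
    fderiv ℝ (fun p => fderiv ℝ G p v) p w = fderiv ℝ (fun p => fderiv ℝ G p w) p v := by
  have hs : IsSymmSndFDerivAt ℝ G p := hG.contDiffAt.isSymmSndFDerivAt (by simp; exact ENat.LEInfty.out)
  have hd : DifferentiableAt ℝ (fderiv ℝ G) p :=
    (hG.fderiv_right (m := (⊤ : ℕ∞)) (by simp)).differentiable (by simp) p
  rw [fderiv_clm_apply hd (by fun_prop), fderiv_clm_apply hd (by fun_prop)]
  simpa using hs w v

lemma pd_zero_succ (F : ℝ → ℝ → ℝ) (a : ℕ) (x y : ℝ) :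
    pd F (a+1) 0 x y = deriv (fun x' => pd F a 0 x' y) x := by
  simp [pd, iteratedDeriv_succ]

lemma pd_succ (F : ℝ → ℝ → ℝ) (a b : ℕ) (x y : ℝ) :
    pd F a (b+1) x y = deriv (fun y' => pd F a b x y') y := by
  simp only [pd, iteratedDeriv_succ]

lemma pd_smooth (F : ℝ → ℝ → ℝ) (hF : ContDiff ℝ (⊤ : ℕ∞) (fun p : ℝ × ℝ => F p.1 p.2))
    (a b : ℕ) : ContDiff ℝ (⊤ : ℕ∞) (fun p : ℝ × ℝ => pd F a b p.1 p.2) := by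
  induction b with
  | zero =>
    induction a with
    | zero => simpa [pd] using hF
    | succ a ih =>
      convert smooth_fd ih (1,0) using 2 with p
      rw [pd_zero_succ]
      exact (hasDeriv_x ih p.1 p.2).deriv
  | succ b ih =>
      convert smooth_fd ih (0,1) using 2 with p
      rw [pd_succ]
      exact (hasDeriv_y ih p.1 p.2).deriv

lemma pd_hasDeriv_y (F : ℝ → ℝ → ℝ) (hF : ContDiff ℝ (⊤ : ℕ∞) (fun p : ℝ × ℝ => F p.1 p.2))
    (a b : ℕ) (x y : ℝ) : HasDerivAt (fun y' => pd F a b x y') (pd F a (b+1) x y) y := by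
  rw [pd_succ]
  exact (hasDeriv_y (pd_smooth F hF a b) x y).differentiableAt.hasDerivAt

lemma pd_hasDeriv_x (F : ℝ → ℝ → ℝ) (hF : ContDiff ℝ (⊤ : ℕ∞) (fun p : ℝ × ℝ => F p.1 p.2))
    (a b : ℕ) (x y : ℝ) : HasDerivAt (fun x' => pd F a b x' y) (pd F (a+1) b x y) x := by
  induction b generalizing x y with
  | zero =>
    rw [pd_zero_succ]
    exact (hasDeriv_x (pd_smooth F hF a 0) x y).differentiableAt.hasDerivAt
  | succ b ih =>
    have hs := pd_smooth F hF a b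
    have e1 : ∀ p : ℝ × ℝ, pd F (a+1) b p.1 p.2 =
        fderiv ℝ (fun p : ℝ × ℝ => pd F a b p.1 p.2) p (1, 0) := fun p =>
      (ih p.1 p.2).unique (hasDeriv_x hs p.1 p.2)
    have e2 : ∀ p : ℝ × ℝ, pd F a (b+1) p.1 p.2 =
        fderiv ℝ (fun p : ℝ × ℝ => pd F a b p.1 p.2) p (0, 1) := fun p =>
      (pd_hasDeriv_y F hF a b p.1 p.2).unique (hasDeriv_y hs p.1 p.2)
    have h := hasDeriv_x (pd_smooth F hF a (b+1)) x y
    have h2 := (pd_hasDeriv_y F hF (a+1) b x y).unique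
      (hasDeriv_y (pd_smooth F hF (a+1) b) x y)
    rw [h2]
    convert h using 1
    rw [funext e1, funext e2]
    exact fd_fd hs _ _ _

section comb
open Finset
open scoped Classical

noncomputable def Pt {α : Type} (s : Finset α) : Finset (Finset (Finset α)) :=
  s.powerset.powerset.filter (fun P => (∀ B ∈ P, B.Nonempty) ∧ (∀ i ∈ s, ∃ B ∈ P, i ∈ B) ∧
    ∀ B ∈ P, ∀ C ∈ P, ∀ i, i ∈ B → i ∈ C → B = C)

lemma mem_Pt {α : Type} {s : Finset α} {P : Finset (Finset α)} : P ∈ Pt s ↔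
    (∀ B ∈ P, B ⊆ s) ∧ (∀ B ∈ P, B.Nonempty) ∧ (∀ i ∈ s, ∃ B ∈ P, i ∈ B) ∧
    ∀ B ∈ P, ∀ C ∈ P, ∀ i, i ∈ B → i ∈ C → B = C := by
  simp [Pt, Finset.subset_iff]

/-- partitions with a given singleton block -/
lemma sum_singleton_block {α : Type} {s : Finset α} {l : α} (hl : l ∈ s)
    (g : Finset (Finset α) → ℝ) :
    ∑ P ∈ (Pt s).filter (fun P => {l} ∈ P), g P = ∑ P ∈ Pt (s.erase l), g (insert {l} P) := by
  have key : ∀ P ∈ Pt (s.erase l), {l} ∉ P := by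
    intro P hP h
    have := (mem_Pt.1 hP).1 _ h
    simp at this
  refine Finset.sum_nbij' (fun P => P.erase {l}) (fun P => insert {l} P) ?_ ?_ ?_ ?_ ?_
  · intro P hP
    rw [mem_filter, mem_Pt] at hP
    obtain ⟨⟨h1, h2, h3, h4⟩, h5⟩ := hP
    rw [mem_Pt]
    refine ⟨?_, ?_, ?_, ?_⟩
    · intro B hB i hi
      have hB' := mem_erase.1 hB
      refine mem_erase.2 ⟨?_, h1 B hB'.2 hi⟩
      rintro rfl
      exact hB'.1 (h4 _ hB'.2 _ h5 i hi (by simp))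
    · intro B hB; exact h2 B (mem_of_mem_erase hB)
    · intro i hi
      obtain ⟨B, hB, hiB⟩ := h3 i (mem_of_mem_erase hi)
      refine ⟨B, mem_erase.2 ⟨?_, hB⟩, hiB⟩
      rintro rfl
      simp at hiB hi
      exact hi.1 hiB
    · intro B hB C hC
      exact h4 B (mem_of_mem_erase hB) C (mem_of_mem_erase hC)
  · intro P hP
    rw [mem_Pt] at hP
    obtain ⟨h1, h2, h3, h4⟩ := hP
    rw [mem_filter, mem_Pt]
    refine ⟨⟨?_, ?_, ?_, ?_⟩, by simp⟩
    · intro B hB i hi; grind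
    · intro B hB; grind
    · intro i hi; grind
    · intro B hB C hC i hi hj; grind
  · intro P hP
    exact insert_erase (mem_filter.1 hP).2
  · intro P hP
    exact erase_insert (key P hP)
  · intro P hP
    rw [insert_erase (mem_filter.1 hP).2]

lemma sum_nonsingleton {α : Type} {s : Finset α} {a : α} (ha : a ∉ s)
    (g : Finset (Finset α) → ℝ) :
    ∑ P ∈ (Pt (insert a s)).filter (fun P => {a} ∉ P), g P =
    ∑ P ∈ Pt s, ∑ B ∈ P, g (insert (insert a B) (P.erase B)) := by
  have key : ∀ P ∈ Pt s, ∀ B ∈ P, a ∉ B := fun P hP B hB h => ha ((mem_Pt.1 hP).1 B hB h)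
  have key2 : ∀ P ∈ Pt s, ∀ B ∈ P, ∀ C ∈ insert (insert a B) (P.erase B), a ∈ C →
      C = insert a B := by
    intro P hP B hB C hC haC
    rcases mem_insert.1 hC with h | h
    · exact h
    · exact absurd haC (key P hP C (mem_of_mem_erase h))
  rw [Finset.sum_sigma']
  symm
  refine Finset.sum_bij (fun z _ => insert (insert a z.2) (z.1.erase z.2)) ?_ ?_ ?_ ?_
  · rintro ⟨P, B⟩ hz
    rw [mem_sigma] at hz
    obtain ⟨hP, hB⟩ := hz
    simp only at hP hB ⊢
    have k1 := key P hP
    rw [mem_Pt] at hP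
    obtain ⟨h1, h2, h3, h4⟩ := hP
    rw [mem_filter, mem_Pt]
    refine ⟨⟨?_, ?_, ?_, ?_⟩, ?_⟩
    · intro C hC i hi; grind
    · intro C hC
      rcases mem_insert.1 hC with h | h
      · rw [h]; exact insert_nonempty _ _
      · exact h2 C (mem_of_mem_erase h)
    · intro i hi
      rcases mem_insert.1 hi with h | h
      · exact ⟨insert a B, by simp, by simp [h]⟩
      · obtain ⟨C, hC, hiC⟩ := h3 i h
        by_cases hCB : C = B
        · exact ⟨insert a B, by simp, by grind⟩
        · exact ⟨C, by grind, hiC⟩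
    · intro C hC D hD i hi hj
      have := k1 B hB
      rcases mem_insert.1 hC with h | h <;> rcases mem_insert.1 hD with h' | h'
      · rw [h, h']
      · rw [mem_erase] at h'
        subst h
        have := k1 D h'.2
        have := h4 B hB D h'.2 i
        grind
      · rw [mem_erase] at h
        subst h'
        have := k1 C h.2
        have := h4 B hB C h.2 i
        grind
      · exact h4 C (mem_of_mem_erase h) D (mem_of_mem_erase h') i hi hj
    · intro h
      rcases mem_insert.1 h with h | h
      · obtain ⟨j, hj⟩ := h2 B hB
        have : j ∈ ({a} : Finset α) := by rw [h]; simp [hj]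
        rw [mem_singleton] at this
        exact k1 B hB (this ▸ hj)
      · exact k1 _ (mem_of_mem_erase h) (by simp)
  · rintro ⟨P, B⟩ hz ⟨P', B'⟩ hz' h
    rw [mem_sigma] at hz hz'
    obtain ⟨hP, hB⟩ := hz
    obtain ⟨hP', hB'⟩ := hz'
    simp only at hP hB hP' hB' h
    have e : insert a B = insert a B' := by
      refine key2 P' hP' B' hB' _ ?_ (by simp)
      rw [← h]; simp
    have eB : B = B' := by
      rw [← erase_insert (key P hP B hB), e, erase_insert (key P' hP' B' hB')]
    subst eB
    have n1 : insert a B ∉ P.erase B := fun h =>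
      key P hP _ (mem_of_mem_erase h) (by simp)
    have n2 : insert a B ∉ P'.erase B := fun h =>
      key P' hP' _ (mem_of_mem_erase h) (by simp)
    have eP : P.erase B = P'.erase B := by
      rw [← erase_insert n1, h, erase_insert n2]
    have : P = P' := by rw [← insert_erase hB, eP, insert_erase hB']
    subst this; rfl
  · intro Q hQ
    rw [mem_filter, mem_Pt] at hQ
    obtain ⟨⟨h1, h2, h3, h4⟩, h5⟩ := hQ
    obtain ⟨C, hC, haC⟩ := h3 a (by simp)
    have hne : (C.erase a).Nonempty := by
      rw [nonempty_iff_ne_empty]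
      intro h
      rcases (erase_eq_empty_iff _ _).1 h with h | h
      · simp [h] at haC
      · exact h5 (h ▸ hC)
    have hnot : C.erase a ∉ Q.erase C := by
      intro h
      obtain ⟨i, hi⟩ := hne
      exact (mem_erase.1 h).1 (h4 _ (mem_erase.1 h).2 C hC i hi (mem_of_mem_erase hi))
    refine ⟨⟨insert (C.erase a) (Q.erase C), C.erase a⟩, ?_, ?_⟩
    · rw [mem_sigma]
      refine ⟨?_, by simp⟩
      simp only
      rw [mem_Pt]
      refine ⟨?_, ?_, ?_, ?_⟩
      · intro B hB i hi
        rcases mem_insert.1 hB with h | h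
        · subst h
          have := h1 C hC (mem_of_mem_erase hi)
          grind
        · rw [mem_erase] at h
          have := h1 B h.2 hi
          rcases mem_insert.1 this with h' | h'
          · subst h'
            exact absurd (h4 B h.2 C hC i hi haC) h.1
          · exact h'
      · intro B hB
        rcases mem_insert.1 hB with h | h
        · exact h ▸ hne
        · exact h2 B (mem_of_mem_erase h)
      · intro i hi
        obtain ⟨B, hB, hiB⟩ := h3 i (by simp [hi])
        by_cases hBC : B = C
        · exact ⟨C.erase a, by simp, by grind⟩
        · exact ⟨B, by grind, hiB⟩
      · intro B hB D hD i hi hj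
        rcases mem_insert.1 hB with h | h <;> rcases mem_insert.1 hD with h' | h'
        · rw [h, h']
        · rw [mem_erase] at h'
          subst h
          exact absurd (h4 D h'.2 C hC i hj (mem_of_mem_erase hi)) h'.1
        · rw [mem_erase] at h
          subst h'
          exact absurd (h4 B h.2 C hC i hi (mem_of_mem_erase hj)) h.1
        · exact h4 B (mem_of_mem_erase h) D (mem_of_mem_erase h') i hi hj
    · simp only
      rw [insert_erase haC, erase_insert hnot, insert_erase hC]
  · intros; rfl

noncomputable def TT {α : Type} (w : Finset α → ℝ) (s : Finset α) (k : ℕ) : ℝ :=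
  ∑ P ∈ (Pt s).filter (fun P => P.card = k), ∏ B ∈ P, w B

lemma singleton_not_mem {α : Type} {s : Finset α} {a : α} (ha : a ∉ s) {P : Finset (Finset α)}
    (hP : P ∈ Pt s) {B : Finset α} (hB : a ∈ B) : B ∉ P :=
  fun h => ha ((mem_Pt.1 hP).1 _ h hB)

lemma TT_insert {α : Type} (w dw : Finset α → ℝ) (κ : ℝ) {s L : Finset α} {a : α} (ha : a ∉ s)
    (hL : L ⊆ s)
    (hw : ∀ B, B ⊆ s → B.Nonempty →
      w (insert a B) = dw B + κ * ∑ l ∈ L, if B = {l} then 1 else 0) (k : ℕ) :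
    TT w (insert a s) (k+1) = w {a} * TT w s k +
      ∑ P ∈ (Pt s).filter (fun P => P.card = k+1), ∑ B ∈ P, dw B * ∏ C ∈ P.erase B, w C
      + κ * ∑ l ∈ L, TT w (s.erase l) k := by
  have e1 : TT w (insert a s) (k+1) = ∑ P ∈ (Pt (insert a s)),
      if P.card = k+1 then ∏ B ∈ P, w B else 0 := by
    rw [TT, sum_filter]
  rw [e1, ← sum_filter_add_sum_filter_not _ (fun P => {a} ∈ P),
    sum_singleton_block (mem_insert_self a s), sum_nonsingleton ha, erase_insert ha, add_assoc]
  congr 1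
  · rw [TT, sum_filter, mul_sum]
    refine sum_congr rfl fun P hP => ?_
    have := singleton_not_mem ha hP (mem_singleton_self a)
    rw [card_insert_of_notMem this, prod_insert this]
    simp
  · have e2 : ∀ l ∈ L, TT w (s.erase l) k = ∑ P ∈ (Pt s).filter (fun P => P.card = k+1),
        ∑ B ∈ P, if B = {l} then ∏ C ∈ P.erase B, w C else 0 := by
      intro l hl
      have : ∀ P : Finset (Finset α), (∑ B ∈ P, if B = {l} then ∏ C ∈ P.erase B, w C else 0)
        = if {l} ∈ P then ∏ C ∈ P.erase {l}, w C else 0 := by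
        intro P
        rw [sum_ite_eq']
      simp_rw [this]
      rw [← sum_filter, filter_comm, sum_filter, sum_singleton_block (hL hl), TT, sum_filter]
      refine sum_congr rfl fun P hP => ?_
      have := singleton_not_mem (notMem_erase l s) hP (mem_singleton_self l)
      rw [card_insert_of_notMem this, erase_insert this]
      simp
    rw [sum_congr rfl e2, sum_comm, mul_sum, ← sum_add_distrib, sum_filter]
    refine sum_congr rfl fun P hP => ?_
    have hcard : ∀ B ∈ P, (insert (insert a B) (P.erase B)).card = P.card := by
      intro B hB
      rw [card_insert_of_notMem, card_erase_add_one hB]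
      exact fun h => singleton_not_mem ha hP (mem_insert_self a B) (mem_of_mem_erase h)
    rw [sum_congr rfl fun B hB => by rw [hcard B hB]]
    split_ifs with hk
    · rw [sum_comm, mul_sum, ← sum_add_distrib]
      refine sum_congr rfl fun B hB => ?_
      rw [prod_insert (fun h => singleton_not_mem ha hP (mem_insert_self a B) (mem_of_mem_erase h)),
        hw B ((mem_Pt.1 hP).1 B hB) ((mem_Pt.1 hP).2.1 B hB), add_mul, mul_assoc, sum_mul]
      simp only [ite_mul, one_mul, zero_mul]
    · simp

/-- transport -/
lemma Pt_map {α β : Type} {s : Finset α} {t : Finset β} (f : α → β) (g : β → α)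
    (hf : ∀ i ∈ s, f i ∈ t) (hg : ∀ j ∈ t, g j ∈ s) (hgf : ∀ i ∈ s, g (f i) = i)
    (hfg : ∀ j ∈ t, f (g j) = j) {P : Finset (Finset α)} (hP : P ∈ Pt s) :
    P.image (fun B => B.image f) ∈ Pt t := by
  rw [mem_Pt] at hP ⊢
  obtain ⟨h1, h2, h3, h4⟩ := hP
  simp only [mem_image, forall_exists_index, and_imp, forall_apply_eq_imp_iff₂, image_nonempty]
  refine ⟨?_, h2, ?_, ?_⟩
  · intro B hB j hj
    obtain ⟨i, hi, rfl⟩ := mem_image.1 hj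
    exact hf i (h1 B hB hi)
  · intro j hj
    obtain ⟨B, hB, h⟩ := h3 (g j) (hg j hj)
    exact ⟨_, ⟨B, hB, rfl⟩, mem_image.2 ⟨_, h, hfg j hj⟩⟩
  · intro B hB C hC i hi i' hi' hij
    have : i = i' := by
      rw [← hgf i (h1 B hB hi), ← hgf i' (h1 C hC hi'), hij]
    subst this
    rw [h4 B hB C hC i hi hi']

lemma image_image_id {α β : Type} {s : Finset α} (f : α → β) (g : β → α)
    (hgf : ∀ i ∈ s, g (f i) = i) {B : Finset α} (hB : B ⊆ s) : (B.image f).image g = B := by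
  ext i
  simp only [mem_image, exists_exists_and_eq_and]
  constructor
  · rintro ⟨j, hj, rfl⟩; rwa [hgf j (hB hj)]
  · intro hi; exact ⟨i, hi, hgf i (hB hi)⟩

lemma image_image_id2 {α β : Type} {s : Finset α} (f : α → β) (g : β → α)
    (hgf : ∀ i ∈ s, g (f i) = i) {P : Finset (Finset α)} (hP : P ∈ Pt s) :
    (P.image (fun B => B.image f)).image (fun B => B.image g) = P := by
  have h1 := (mem_Pt.1 hP).1
  ext B
  simp only [mem_image, exists_exists_and_eq_and]
  constructor
  · rintro ⟨C, hC, rfl⟩; rwa [image_image_id f g hgf (h1 C hC)]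
  · intro hi; exact ⟨B, hi, image_image_id f g hgf (h1 B hi)⟩

lemma TT_transport {α β : Type} {s : Finset α} {t : Finset β} (f : α → β) (g : β → α)
    (hf : ∀ i ∈ s, f i ∈ t) (hg : ∀ j ∈ t, g j ∈ s) (hgf : ∀ i ∈ s, g (f i) = i)
    (hfg : ∀ j ∈ t, f (g j) = j) (w : Finset α → ℝ) (v : Finset β → ℝ)
    (hwv : ∀ B ⊆ s, v (B.image f) = w B) (k : ℕ) : TT w s k = TT v t k := by
  have inj : ∀ P ∈ Pt s, Set.InjOn (fun B => B.image f) (P : Set (Finset α)) := by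
    intro P hP B hB C hC h
    have h1 := (mem_Pt.1 hP).1
    simp only at h
    rw [← image_image_id f g hgf (h1 B hB), h, image_image_id f g hgf (h1 C hC)]
  have inj' : ∀ P ∈ Pt t, Set.InjOn (fun B => B.image g) (P : Set (Finset β)) := by
    intro P hP B hB C hC h
    have h1 := (mem_Pt.1 hP).1
    simp only at h
    rw [← image_image_id g f hfg (h1 B hB), h, image_image_id g f hfg (h1 C hC)]
  refine Finset.sum_nbij' (fun P => P.image (fun B => B.image f))
    (fun P => P.image (fun B => B.image g)) ?_ ?_ ?_ ?_ ?_
  · intro P hP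
    rw [mem_filter] at hP ⊢
    exact ⟨Pt_map f g hf hg hgf hfg hP.1, by rw [card_image_of_injOn (inj P hP.1), hP.2]⟩
  · intro P hP
    rw [mem_filter] at hP ⊢
    exact ⟨Pt_map g f hg hf hfg hgf hP.1, by rw [card_image_of_injOn (inj' P hP.1), hP.2]⟩
  · intro P hP
    exact image_image_id2 f g hgf (mem_filter.1 hP).1
  · intro P hP
    exact image_image_id2 g f hfg (mem_filter.1 hP).1
  · intro P hP
    have hP := (mem_filter.1 hP).1
    rw [prod_image (inj P hP)]
    exact prod_congr rfl fun B hB => (hwv B ((mem_Pt.1 hP).1 B hB)).symm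

lemma card_filter_att {α : Type} (s : Finset α) (c : α → Prop) [DecidablePred c]
    [DecidablePred (fun i : {i // i ∈ s} => c i.1)] :
    ((univ : Finset {i // i ∈ s}).filter (fun i : {i // i ∈ s} => c i.1)).card = (s.filter c).card := by
  refine card_bij (fun i _ => i.1) ?_ ?_ ?_
  · intro i hi; simpa using hi
  · intro i _ j _ h; exact Subtype.ext h
  · intro i hi
    rw [mem_filter] at hi
    exact ⟨⟨i, hi.1⟩, by simpa using hi.2, rfl⟩

lemma exists_fg {α β : Type} (c : α → Prop) (d : β → Prop) {s : Finset α} {t : Finset β}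
    (h1 : (s.filter c).card = (t.filter d).card)
    (h2 : (s.filter (fun i => ¬ c i)).card = (t.filter (fun i => ¬ d i)).card) :
    ∃ (e : {i // i ∈ s} ≃ {j // j ∈ t}), ∀ i, d (e i) ↔ c i := by
  have e1 : {i : {i // i ∈ s} // c i} ≃ {j : {j // j ∈ t} // d j} := by
    refine Fintype.equivOfCardEq ?_
    rw [Fintype.card_subtype, Fintype.card_subtype]
    rw [card_filter_att s c, h1, card_filter_att t d]
  have e2 : {i : {i // i ∈ s} // ¬ c i} ≃ {j : {j // j ∈ t} // ¬ d j} := by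
    refine Fintype.equivOfCardEq ?_
    rw [Fintype.card_subtype, Fintype.card_subtype]
    exact (card_filter_att s (fun i => ¬ c i)).trans
      (h2.trans (card_filter_att t (fun i => ¬ d i)).symm)
  refine ⟨(Equiv.sumCompl (fun i : {i // i ∈ s} => c i)).symm.trans
    ((Equiv.sumCongr e1 e2).trans (Equiv.sumCompl (fun i : {i // i ∈ t} => d i))), ?_⟩
  intro i
  by_cases h : c i
  · simp [h, Equiv.sumCompl_symm_apply_of_pos, (e1 ⟨i, h⟩).2]
  · simp [h, Equiv.sumCompl_symm_apply_of_neg, (e2 ⟨i, h⟩).2]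

lemma exists_fg2 {α β : Type} [Nonempty α] [Nonempty β] (c : α → Prop) (d : β → Prop)
    {s : Finset α} {t : Finset β}
    (h1 : (s.filter c).card = (t.filter d).card)
    (h2 : (s.filter (fun i => ¬ c i)).card = (t.filter (fun i => ¬ d i)).card) :
    ∃ (f : α → β) (g : β → α), (∀ i ∈ s, f i ∈ t) ∧ (∀ j ∈ t, g j ∈ s) ∧
      (∀ i ∈ s, g (f i) = i) ∧ (∀ j ∈ t, f (g j) = j) ∧ (∀ i ∈ s, (d (f i) ↔ c i)) := by
  obtain ⟨e, he⟩ := exists_fg c d h1 h2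
  refine ⟨fun i => if h : i ∈ s then e ⟨i, h⟩ else Classical.arbitrary β,
    fun j => if h : j ∈ t then e.symm ⟨j, h⟩ else Classical.arbitrary α, ?_, ?_, ?_, ?_, ?_⟩
  · intro i hi; simp [hi]
  · intro i hi; simp [hi]
  · intro i hi; simp [hi]
  · intro i hi; simp [hi]
  · intro i hi; simp [hi, he]

noncomputable def cw {α : Type} (c : α → Prop) (W : ℕ → ℕ → ℝ) (B : Finset α) : ℝ :=
  W (B.filter c).card (B.filter (fun i => ¬ c i)).card

lemma TT_counts {α β : Type} [Nonempty α] [Nonempty β] (c : α → Prop) (d : β → Prop)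
    {s : Finset α} {t : Finset β}
    (h1 : (s.filter c).card = (t.filter d).card)
    (h2 : (s.filter (fun i => ¬ c i)).card = (t.filter (fun i => ¬ d i)).card)
    (W : ℕ → ℕ → ℝ) (k : ℕ) : TT (cw c W) s k = TT (cw d W) t k := by
  obtain ⟨f, g, hf, hg, hgf, hfg, hc⟩ := exists_fg2 c d h1 h2
  refine TT_transport f g hf hg hgf hfg _ _ ?_ k
  intro B hB
  have inj : Set.InjOn f (B : Set α) := by
    intro i hi j hj h
    rw [← hgf i (hB hi), h, hgf j (hB hj)]
  have e1 : (B.image f).filter d = (B.filter c).image f := by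
    rw [filter_image]
    congr 1
    exact filter_congr fun i hi => hc i (hB hi)
  have e2 : (B.image f).filter (fun i => ¬ d i) = (B.filter (fun i => ¬ c i)).image f := by
    rw [filter_image]
    congr 1
    exact filter_congr fun i hi => not_congr (hc i (hB hi))
  rw [cw, cw, e1, e2, card_image_of_injOn (inj.mono (coe_subset.2 (filter_subset _ _))),
    card_image_of_injOn (inj.mono (coe_subset.2 (filter_subset _ _)))]

structure SN where
  b : Prop
  v : ℕ

instance : Nonempty SN := ⟨⟨True, 0⟩⟩

def isS (i : SN) : Prop := i.b

noncomputable def base (n m : ℕ) : Finset SN :=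
  (range n).image (fun i => SN.mk True i) ∪ (range m).image (fun i => SN.mk False i)

lemma mem_base {n m : ℕ} {i : SN} : i ∈ base n m ↔ (i.b ∧ i.v < n) ∨ (¬ i.b ∧ i.v < m) := by
  obtain ⟨b, v⟩ := i
  by_cases hb : b <;> simp [base, hb]

/-- `n` small elements and `m` large ones -/
noncomputable def UU (W : ℕ → ℕ → ℝ) (n m k : ℕ) : ℝ :=
  TT (cw isS W) (base n m) k

lemma cntS (n m : ℕ) : ((base n m).filter isS).card = n := by
  have : (base n m).filter isS = (range n).image (fun i => SN.mk True i) := by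
    ext ⟨b, v⟩
    rw [mem_filter, mem_base]
    by_cases hb : b <;> simp [isS, hb]
  rw [this, card_image_of_injective _ (fun i j h => by simpa using h), card_range]

lemma cntL (n m : ℕ) :
    ((base n m).filter (fun i => ¬ isS i)).card = m := by
  have : (base n m).filter (fun i => ¬ isS i) = (range m).image (fun i => SN.mk False i) := by
    ext ⟨b, v⟩
    rw [mem_filter, mem_base]
    by_cases hb : b <;> simp [isS, hb]
  rw [this, card_image_of_injective _ (fun i j h => by simpa using h), card_range]

lemma TT_eq_UU {α : Type} [Nonempty α] (c : α → Prop) {s : Finset α} {n m : ℕ}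
    (h1 : (s.filter c).card = n) (h2 : (s.filter (fun i => ¬ c i)).card = m)
    (W : ℕ → ℕ → ℝ) (k : ℕ) : TT (cw c W) s k = UU W n m k := by
  refine TT_counts _ _ ?_ ?_ W k
  · rw [h1, cntS]
  · rw [h2, cntL]

lemma TT_Pt_empty {α : Type} (w : Finset α → ℝ) {s : Finset α} (hs : s.Nonempty) :
    TT w s 0 = 0 := by
  rw [TT]
  refine sum_eq_zero fun P hP => ?_
  rw [mem_filter, card_eq_zero] at hP
  obtain ⟨i, hi⟩ := hs
  obtain ⟨B, hB, _⟩ := (mem_Pt.1 hP.1).2.2.1 i hi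
  simp [hP.2] at hB

lemma ind_sum {α : Type} (c : α → Prop) (s : Finset α) (B : Finset α) (hB : B ⊆ s) :
    (∑ l ∈ s.filter (fun i => ¬ c i), if B = {l} then (1 : ℝ) else 0) =
      if (B.filter c).card = 0 ∧ (B.filter (fun i => ¬ c i)).card = 1 then 1 else 0 := by
  split_ifs with h
  · have hc : B.card = 1 := by
      rw [← card_filter_add_card_filter_not (s := B) c, h.1, h.2]
    obtain ⟨l, rfl⟩ := card_eq_one.1 hc
    have hl : ¬ c l := by
      intro hl
      have := h.1
      simp [filter_singleton, hl] at this
    rw [sum_eq_single l]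
    · simp
    · intro j _ hj
      rw [if_neg]
      intro h; exact hj (singleton_injective h).symm
    · intro hh
      exact absurd (mem_filter.2 ⟨hB (mem_singleton_self l), hl⟩) hh
  · refine sum_eq_zero fun l hl => ?_
    rw [if_neg]
    rintro rfl
    have := (mem_filter.1 hl).2
    apply h
    simp [filter_singleton, this]

lemma erase_cnt {n m : ℕ} {l : SN}
    (hl : l ∈ (base n m).filter (fun i => ¬ isS i)) (W : ℕ → ℕ → ℝ) (k : ℕ) :
    TT (cw isS W) ((base n m).erase l) k = UU W n (m-1) k := by
  refine TT_eq_UU _ ?_ ?_ W k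
  · rw [← erase_eq_of_notMem (a := l) (s := filter isS ((base n m).erase l)),
      ← filter_erase, erase_idem, filter_erase, erase_eq_of_notMem, cntS]
    · intro h; exact (mem_filter.1 hl).2 (mem_filter.1 h).2
    · intro h; exact (mem_filter.1 hl).2 (mem_filter.1 h).2
  · rw [filter_erase, card_erase_of_mem hl, cntL]

lemma UU_ins_x (W dW : ℕ → ℕ → ℝ) (κ : ℝ)
    (hW : ∀ a b, W (a+1) b = dW a b + κ * if a = 0 ∧ b = 1 then 1 else 0) (n m k : ℕ) :
    UU W (n+1) m (k+1) = W 1 0 * UU W n m k +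
      ∑ P ∈ (Pt (base n m)).filter (fun P => P.card = k+1),
        ∑ B ∈ P, cw isS dW B * ∏ C ∈ P.erase B, cw isS W C
      + κ * (m * UU W n (m-1) k) := by
  have ha : (SN.mk True n) ∉ base n m := by simp [mem_base]
  have hs : base (n+1) m =
      insert (SN.mk True n) (base n m) := by
    ext ⟨b, v⟩
    by_cases hb : b <;> simp [mem_base, hb]
    omega
  have hc : isS (SN.mk True n) := trivial
  rw [UU, hs, TT_insert (cw isS W) (cw isS dW) κ ha (filter_subset (fun i => ¬ isS i) _),
    sum_congr rfl (fun l hl => erase_cnt hl W k), sum_const, cntL]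
  · rw [nsmul_eq_mul]
    simp [cw, filter_singleton, hc, UU]
  · intro B hB _
    have hn : (SN.mk True n) ∉ B := fun h => ha (hB h)
    rw [ind_sum _ _ _ hB]
    simp only [cw]
    rw [filter_insert, if_pos hc, filter_insert, if_neg (not_not.2 hc),
      card_insert_of_notMem (fun h => hn (mem_filter.1 h).1), hW]

lemma UU_ins_y (W dW : ℕ → ℕ → ℝ) (κ : ℝ)
    (hW : ∀ a b, a + b ≠ 0 → W a (b+1) = dW a b + κ * if a = 0 ∧ b = 1 then 1 else 0)
    (n m k : ℕ) :
    UU W n (m+1) (k+1) = W 0 1 * UU W n m k +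
      ∑ P ∈ (Pt (base n m)).filter (fun P => P.card = k+1),
        ∑ B ∈ P, cw isS dW B * ∏ C ∈ P.erase B, cw isS W C
      + κ * (m * UU W n (m-1) k) := by
  have ha : (SN.mk False m) ∉ base n m := by simp [mem_base]
  have hs : base n (m+1) =
      insert (SN.mk False m) (base n m) := by
    ext ⟨b, v⟩
    by_cases hb : b <;> simp [mem_base, hb]
    omega
  have hc : ¬ isS (SN.mk False m) := by simp [isS]
  rw [UU, hs, TT_insert (cw isS W) (cw isS dW) κ ha (filter_subset (fun i => ¬ isS i) _),
    sum_congr rfl (fun l hl => erase_cnt hl W k), sum_const, cntL]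
  · rw [nsmul_eq_mul]
    simp [cw, filter_singleton, hc, UU]
  · intro B hB hne
    have hn : (SN.mk False m) ∉ B := fun h => ha (hB h)
    rw [ind_sum _ _ _ hB]
    simp only [cw]
    rw [filter_insert, if_neg hc, filter_insert, if_pos hc,
      card_insert_of_notMem (fun h => hn (mem_filter.1 h).1), hW]
    rw [card_filter_add_card_filter_not]
    exact (card_pos.2 hne).ne'

lemma UU_hasDeriv (W : ℝ → ℕ → ℕ → ℝ) (dW : ℕ → ℕ → ℝ) (x : ℝ)
    (h : ∀ a b, HasDerivAt (fun x => W x a b) (dW a b) x) (n m k : ℕ) :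
    HasDerivAt (fun x => UU (W x) n m k)
      (∑ P ∈ (Pt (base n m)).filter (fun P => P.card = k),
        ∑ B ∈ P, cw isS dW B * ∏ C ∈ P.erase B, cw isS (W x) C) x := by
  unfold UU TT
  refine HasDerivAt.fun_sum fun P _ => ?_
  have := HasDerivAt.fun_finsetProd (u := P) (f := fun B x => cw isS (W x) B)
    (f' := fun B => cw isS dW B) (x := x) (fun B _ => h _ _)
  have e : ∑ B ∈ P, cw isS dW B * ∏ C ∈ P.erase B, cw isS (W x) C =
      ∑ B ∈ P, (∏ C ∈ P.erase B, cw isS (W x) C) • cw isS dW B :=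
    sum_congr rfl fun B _ => by rw [smul_eq_mul, mul_comm]
  rw [e]
  exact this
end comb

section final
open Finset
open scoped Classical

noncomputable def wt (F : ℝ → ℝ → ℝ) (x y : ℝ) (a b : ℕ) : ℝ :=
  if a = 0 ∧ b = 1 then 0 else pd F a b x y

lemma cnt_fin (n N : ℕ) (h : n ≤ N) :
    ((univ : Finset (Fin N)).filter (fun i : Fin _ => (i : ℕ) < n)).card = n := by
  rw [Fin.card_filter_val_lt]; omega

lemma card_do {N : ℕ} (B : Finset (Fin N)) (p : ℕ → Prop) (inst : DecidablePred p)
    (inst2 : DecidablePred fun i : Fin N => p i) :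
    ((B >>= fun a => pure (a : ℕ)).filter p).card = (B.filter (fun i : Fin N => p i)).card := by
  symm
  refine card_bij (fun i _ => (i : ℕ)) ?_ ?_ ?_
  · intro i hi
    have := mem_filter.1 hi
    simp only [mem_filter]
    exact ⟨by simp; exact ⟨i, this.1, rfl⟩, this.2⟩
  · intro i _ j _ h; exact Fin.ext h
  · intro j hj
    simp at hj
    obtain ⟨⟨i, hi, rfl⟩, hp⟩ := hj
    exact ⟨i, by simp [hi, hp], rfl⟩

lemma iSum_eq (F : ℝ → ℝ → ℝ) (n : ℕ) (hn : 1 ≤ n) (k : ℤ) (hk : 1 ≤ k) (x y : ℝ) :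
    iSum F n k x y = UU (wt F x y) n (k.toNat - 1) k.toNat := by
  have hN : 1 ≤ k.toNat := by omega
  rw [iSum, if_neg (by omega)]
  simp only [card_do]
  generalize k.toNat = K at *
  have : Nonempty (Fin (n + K - 1)) := ⟨⟨0, by omega⟩⟩
  have c1 : ((univ : Finset (Fin (n+K-1))).filter (fun i : Fin _ => (i : ℕ) < n)).card = n :=
    cnt_fin _ _ (by omega)
  have c2 : ((univ : Finset (Fin (n+K-1))).filter (fun i : Fin _ => ¬ (i : ℕ) < n)).card = K - 1 := by
    have := card_filter_add_card_filter_not (s := (univ : Finset (Fin (n+K-1))))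
      (fun i : Fin _ => (i : ℕ) < n)
    rw [c1, card_univ, Fintype.card_fin] at this
    omega
  rw [← TT_eq_UU (fun i : Fin (n+K-1) => (i : ℕ) < n) (by convert c1) (by convert c2), TT]
  have cww : ∀ B : Finset (Fin (n+K-1)), cw (fun i : Fin (n+K-1) => (i : ℕ) < n) (wt F x y) B =
      wt F x y (B.filter (fun i : Fin _ => (i : ℕ) < n)).card (B.filter (fun i : Fin _ => ¬ (i : ℕ) < n)).card := by
    intro B; unfold cw; congr!
  simp only [cww]
  have hiff : ∀ B : Finset (Fin (n+K-1)), ((B.filter (fun i : Fin _ => (i : ℕ) < n)).card = 0 ∧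
      (B.filter (fun i : Fin _ => ¬ (i : ℕ) < n)).card = 1) ↔ ¬ (B.card = 1 → ∀ i ∈ B, (i : ℕ) < n) := by
    intro B
    have hs := card_filter_add_card_filter_not (s := B) (fun i : Fin _ => (i : ℕ) < n)
    constructor
    · rintro ⟨h1, h2⟩ h
      have := h (by omega)
      rw [filter_true_of_mem this] at h1
      omega
    · intro h
      rw [Classical.not_imp] at h
      obtain ⟨h1, h2⟩ := h
      obtain ⟨i, rfl⟩ := card_eq_one.1 h1
      have : ¬ (i : ℕ) < n := by simpa using h2
      simp only [filter_singleton, this]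
      simp
  have hmem : ∀ P : Finset (Finset (Fin (n+K-1))), P ∈ Pt univ ↔
      ((∀ B ∈ P, B.Nonempty) ∧ (∀ i, ∃! B, B ∈ P ∧ i ∈ B)) := by
    intro P
    rw [mem_Pt]
    constructor
    · rintro ⟨_, h2, h3, h4⟩
      refine ⟨h2, fun i => ?_⟩
      obtain ⟨B, hB, hi⟩ := h3 i (mem_univ i)
      exact ⟨B, ⟨hB, hi⟩, fun C hC => h4 C hC.1 B hB i hC.2 hi⟩
    · rintro ⟨h2, h3⟩
      refine ⟨fun _ _ => subset_univ _, h2, fun i _ => ?_, fun B hB C hC i hi hj => ?_⟩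
      · obtain ⟨B, hB, _⟩ := h3 i
        exact ⟨B, hB⟩
      · exact (h3 i).unique ⟨hB, hi⟩ ⟨hC, hj⟩
  rw [sum_congr rfl (g := fun P : Finset (Finset (Fin (n+K-1))) => ∏ B ∈ P,
    wt F x y (B.filter (fun i : Fin _ => (i : ℕ) < n)).card (B.filter (fun i : Fin _ => ¬ (i : ℕ) < n)).card)]
  · refine sum_subset ?_ ?_
    · intro P hP
      obtain ⟨_, h1, h2, h3, h4⟩ := mem_filter.1 hP
      exact mem_filter.2 ⟨(hmem P).2 ⟨h1, h2⟩, h3⟩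
    · intro P hP hP'
      obtain ⟨h1, h2⟩ := mem_filter.1 hP
      rw [hmem] at h1
      have : ¬ ∀ B ∈ P, B.card = 1 → ∀ i ∈ B, (i : ℕ) < n := fun h =>
        hP' (mem_filter.2 ⟨mem_univ _, h1.1, h1.2, h2, h⟩)
      push Not at this
      obtain ⟨B, hB, hB1, hB2⟩ := this
      refine prod_eq_zero hB ?_
      rw [wt, if_pos]
      rw [hiff]
      push Not
      exact ⟨hB1, hB2⟩
  · intro P hP
    obtain ⟨_, h1, h2, h3, h4⟩ := mem_filter.1 hP
    refine prod_congr rfl fun B hB => ?_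
    rw [wt, if_neg]
    rw [hiff, not_not]
    exact h4 B hB

lemma iSum_eq_zero (F : ℝ → ℝ → ℝ) (n : ℕ) (k : ℤ) (hk : k < 1) (x y : ℝ) :
    iSum F n k x y = 0 := by
  rw [iSum, if_pos hk]

lemma UU_rec_x (F : ℝ → ℝ → ℝ)
    (hF : ContDiff ℝ (⊤ : ℕ∞) (fun p : ℝ × ℝ => F p.1 p.2)) (n m k : ℕ) (x y : ℝ) :
    UU (wt F x y) (n+1) m (k+1) = pd F 1 0 x y * UU (wt F x y) n m k
      + deriv (fun x' => UU (wt F x' y) n m (k+1)) x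
      + pd F 1 1 x y * (m * UU (wt F x y) n (m-1) k) := by
  have h := UU_hasDeriv (fun x' => wt F x' y)
    (fun a b => if a = 0 ∧ b = 1 then 0 else pd F (a+1) b x y) x (by
      intro a b
      simp only [wt]
      split_ifs
      · exact hasDerivAt_const _ _
      · exact pd_hasDeriv_x F hF a b x y) n m (k+1)
  rw [h.deriv, UU_ins_x (wt F x y) (fun a b => if a = 0 ∧ b = 1 then 0 else pd F (a+1) b x y)
    (pd F 1 1 x y)]
  · simp [wt]
  · intro a b
    by_cases h2 : a = 0 ∧ b = 1
    · rw [h2.1, h2.2]; simp [wt]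
    · simp [wt, h2]

lemma UU_rec_y (F : ℝ → ℝ → ℝ)
    (hF : ContDiff ℝ (⊤ : ℕ∞) (fun p : ℝ × ℝ => F p.1 p.2)) (n m k : ℕ) (x y : ℝ) :
    UU (wt F x y) n (m+1) (k+1) = 
      deriv (fun y' => UU (wt F x y') n m (k+1)) y
      + pd F 0 2 x y * (m * UU (wt F x y) n (m-1) k) := by
  have h := UU_hasDeriv (fun y' => wt F x y')
    (fun a b => if a = 0 ∧ b = 1 then 0 else pd F a (b+1) x y) y (by
      intro a b
      simp only [wt]
      split_ifs
      · exact hasDerivAt_const _ _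
      · exact pd_hasDeriv_y F hF a b x y) n m (k+1)
  rw [h.deriv, UU_ins_y (wt F x y) (fun a b => if a = 0 ∧ b = 1 then 0 else pd F a (b+1) x y)
    (pd F 0 2 x y)]
  · simp [wt]
  · intro a b
    simp only [wt]
    intro hab
    split_ifs with h1 h2 h2
    · omega
    · omega
    · rw [h2.1, h2.2]; simp
    · simp

end final


/-- **Recurrence for `I_{n,k}`:**
`I_{n+1,k} = ∂/∂x I_{n,k} + F_x · ∂/∂y I_{n,k−1} + (k−1)·F_xy · I_{n,k−1}
  + (k−2)·F_x·F_yy · I_{n,k−2}`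
for a smooth `F` and all integers `n ≥ 1` and `k`, as functions of `(x, y)`. -/
theorem iSum_recurrence (F : ℝ → ℝ → ℝ)
    (hF : ContDiff ℝ (⊤ : ℕ∞) (fun p : ℝ × ℝ => F p.1 p.2))
    (n : ℕ) (hn : 1 ≤ n) (k : ℤ) (x y : ℝ) :
    iSum F (n + 1) k x y =
      deriv (fun x' => iSum F n k x' y) x
        + pd F 1 0 x y * deriv (fun y' => iSum F n (k - 1) x y') y
        + ((k : ℝ) - 1) * pd F 1 1 x y * iSum F n (k - 1) x y
        + ((k : ℝ) - 2) * pd F 1 0 x y * pd F 0 2 x y * iSum F n (k - 2) x y := by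
  rcases lt_or_ge k 1 with hk | hk
  · simp only [iSum_eq_zero F _ k hk, iSum_eq_zero F _ (k-1) (by omega),
      iSum_eq_zero F _ (k-2) (by omega)]
    simp
  obtain ⟨K, rfl⟩ : ∃ K : ℕ, k = (K : ℤ) + 1 := ⟨(k-1).toNat, by omega⟩
  have t1 : ((K : ℤ) + 1).toNat = K + 1 := by omega
  have hx : ∀ x', iSum F n ((K : ℤ) + 1) x' y = UU (wt F x' y) n K (K+1) := fun x' => by
    rw [iSum_eq F n hn _ hk, t1]; rfl
  rw [iSum_eq F (n+1) (by omega) _ hk, t1, Nat.add_sub_cancel, UU_rec_x F hF, funext hx]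
  rcases K with _ | K
  · simp only [iSum_eq_zero F _ ((((0:ℕ) : ℤ) + 1) - 1) (by omega),
      iSum_eq_zero F _ ((((0:ℕ) : ℤ) + 1) - 2) (by omega)]
    have : UU (wt F x y) n 0 0 = 0 := by
      refine TT_Pt_empty _ ⟨SN.mk True 0, ?_⟩
      simp [mem_base]; omega
    simp [this]
  have hy : ∀ y', iSum F n (((K+1 : ℕ) : ℤ) + 1 - 1) x y' = UU (wt F x y') n K (K+1) :=
    fun y' => by
      have t2 : (((K+1 : ℕ) : ℤ) + 1 - 1).toNat = K + 1 := by omega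
      rw [iSum_eq F n hn _ (by omega), t2]; rfl
  simp only [hy]
  rw [UU_rec_y F hF]
  rcases K with _ | K
  · simp only [iSum_eq_zero F _ ((((0+1:ℕ) : ℤ) + 1) - 2) (by omega)]
    simp
    ring
  have hz : iSum F n (((K+1+1 : ℕ) : ℤ) + 1 - 2) x y = UU (wt F x y) n K (K+1) := by
      have t2 : (((K+1+1 : ℕ) : ℤ) + 1 - 2).toNat = K + 1 := by omega
      rw [iSum_eq F n hn _ (by omega), t2]; rfl
  rw [hz]
  simp only [Nat.add_sub_cancel]
  push_cast
  ring
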